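/- Let F be a free group. If A and B are distinct free factors of F each of rank 2, then their intersection A ∩ B is a cyclic group (possibly trivial). -/

import Mathlib

/-- A subgroup `A` of a group `F` is a *free factor* if `F` decomposes as an
internal free product `F = A * B` for some subgroup `B`, i.e. the natural map
from the coproduct `A ∗ B` to `F` is an isomorphism. -/
def IsFreeFactor {F : Type*} [Group F] (A : Subgroup F) : Prop :=
  ∃ B : Subgroup F, Function.Bijective (Monoid.Coprod.lift A.subtype B.subtype)

/-- `A` has rank `n`: it is isomorphic to the free group on `n` generators. -/
def HasRank {F : Type*} [Group F] (A : Subgroup F) (n : ℕ) : Prop :=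
  Nonempty (A ≃* FreeGroup (Fin n))

open Function

/-- Left multiplication by `g`, restricted to a finite set `T`, extends to a permutation of `T`. -/
theorem exists_perm_eq_mul_left {G : Type*} [Group G] (T : Finset G) (g : G) :
    ∃ σ : Equiv.Perm T, ∀ (t : T) (h : g * t ∈ T), σ t = ⟨g * t, h⟩ := by
  classical
  let e : {t : T // g * t ∈ T} ≃ {t : T // g⁻¹ * t ∈ T} :=
    { toFun := fun t => ⟨⟨g * t.1, t.2⟩, by simp⟩
      invFun := fun t => ⟨⟨g⁻¹ * t.1, t.2⟩, by simp⟩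
      left_inv := fun t => by simp
      right_inv := fun t => by simp }
  exact ⟨e.extendSubtype, fun t h => e.extendSubtype_apply_of_mem t h⟩

/-- Free groups are residually finite. -/
theorem FreeGroup.exists_perm_hom_ne_one {α : Type*} {w : FreeGroup α} (hw : w ≠ 1) :
    ∃ (T : Finset (FreeGroup α)) (θ : FreeGroup α →* Equiv.Perm T), θ w ≠ 1 := by
  classical
  let T : Finset (FreeGroup α) := (w.toWord.tails.map FreeGroup.mk).toFinset
  have hT (L : List (α × Bool)) : L <:+ w.toWord → FreeGroup.mk L ∈ T := fun h => by
    simp only [T, List.mem_toFinset, List.mem_map, List.mem_tails]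
    exact ⟨L, h, rfl⟩
  choose σ hσ using fun x : α => exists_perm_eq_mul_left T (FreeGroup.of x)
  have key (L : List (α × Bool)) (hL : L <:+ w.toWord) :
      FreeGroup.lift σ (FreeGroup.mk L) ⟨1, hT [] (List.nil_suffix)⟩ = ⟨_, hT L hL⟩ := by
    induction L with
    | nil => rfl
    | cons a L ih =>
      have hL' : L <:+ w.toWord := (List.suffix_cons a L).trans hL
      obtain ⟨x, b⟩ := a
      have hm : FreeGroup.mk ((x, b) :: L) = FreeGroup.mk [(x, b)] * FreeGroup.mk L := by
        rw [FreeGroup.mul_mk]; rfl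
      have hmem := hT _ hL
      simp only [hm] at hmem ⊢
      rw [_root_.map_mul, Equiv.Perm.mul_apply, ih hL']
      cases b
      · have hx : FreeGroup.mk [(x, false)] = (FreeGroup.of x)⁻¹ := rfl
        simp only [hx] at hmem ⊢
        rw [_root_.map_inv, FreeGroup.lift_apply_of, Equiv.Perm.inv_eq_iff_eq,
          hσ x ⟨_, hmem⟩ (by simpa using hT L hL')]
        simp
      · exact (congrArg (fun τ : Equiv.Perm T => τ _) FreeGroup.lift_apply_of).trans
          (hσ x ⟨_, hT L hL'⟩ hmem)
  refine ⟨T, FreeGroup.lift σ, fun h => hw ?_⟩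
  have := key w.toWord List.suffix_rfl
  simp only [FreeGroup.mk_toWord, h] at this
  exact (congrArg Subtype.val this).symm

/-- Precomposition with `f` on homomorphisms to `Q`, in terms of the images of the generators. -/
def FreeGroup.precomp {α β : Type*} (Q : Type*) [Group Q] (f : FreeGroup α →* FreeGroup β) :
    (β → Q) → α → Q :=
  fun u => FreeGroup.lift.symm ((FreeGroup.lift u).comp f)

theorem FreeGroup.precomp_injective {α β : Type*} (Q : Type*) [Group Q]
    {f : FreeGroup α →* FreeGroup β} (hf : Surjective f) :
    Injective (FreeGroup.precomp Q f) := fun _ _ h =>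
  FreeGroup.lift.injective <| (MonoidHom.cancel_right hf).1 <| FreeGroup.lift.symm.injective h

theorem FreeGroup.finite_of_surjective {α β : Type*} [Finite α] {f : FreeGroup α →* FreeGroup β}
    (hf : Surjective f) : Finite β := by
  have := Finite.of_injective _ (FreeGroup.precomp_injective (Multiplicative (ZMod 2)) hf)
  by_contra h
  rw [not_finite_iff_infinite] at h
  exact not_finite (β → Multiplicative (ZMod 2))

theorem FreeGroup.card_le_of_surjective {α β : Type*} [Finite α] {f : FreeGroup α →* FreeGroup β}
    (hf : Surjective f) : Nat.card β ≤ Nat.card α := by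
  have := FreeGroup.finite_of_surjective hf
  have h := Nat.card_le_card_of_injective _
    (FreeGroup.precomp_injective (Multiplicative (ZMod 2)) hf)
  rw [Nat.card_fun, Nat.card_fun] at h
  have h2 : Nat.card (Multiplicative (ZMod 2)) = 2 := Nat.card_zmod 2
  rw [h2] at h
  exact (Nat.pow_le_pow_iff_right (by norm_num)).1 h

/-- An epimorphism between free groups of the same finite rank is injective. -/
theorem FreeGroup.injective_of_surjective {α β : Type*} [Finite α]
    (hcard : Nat.card α ≤ Nat.card β) {f : FreeGroup α →* FreeGroup β} (hf : Surjective f) :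
    Injective f := by
  have := FreeGroup.finite_of_surjective hf
  rw [injective_iff_map_eq_one]
  intro w hw
  by_contra hne
  obtain ⟨T, θ, hθ⟩ := FreeGroup.exists_perm_hom_ne_one hne
  have hQ : Nat.card (α → Equiv.Perm T) = Nat.card (β → Equiv.Perm T) := by
    rw [Nat.card_fun, Nat.card_fun, hcard.antisymm (FreeGroup.card_le_of_surjective hf)]
  have hbij := (Nat.bijective_iff_injective_and_card _).2
    ⟨FreeGroup.precomp_injective (Equiv.Perm T) hf, hQ.symm⟩
  obtain ⟨u, hu⟩ := hbij.2 (FreeGroup.lift.symm θ)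
  have : (FreeGroup.lift u).comp f = θ := FreeGroup.lift.symm.injective hu
  exact hθ (by rw [← this, MonoidHom.comp_apply, hw, _root_.map_one])

theorem FreeGroup.isCyclic_of_card_le_one {α : Type*} [Finite α] (h : Nat.card α ≤ 1) :
    IsCyclic (FreeGroup α) := by
  have := Finite.card_le_one_iff_subsingleton.1 h
  rcases isEmpty_or_nonempty α with hα | ⟨⟨a⟩⟩
  · infer_instance
  · have := uniqueOfSubsingleton a
    infer_instance

/-- A cocycle `κ : G × P → C` for an action of `G` on `P` defines an action of `G` on `P × C`. -/
def cocyclePermHom {G P C : Type*} [Group G] [MulAction G P] [Group C] (κ : G → P → C)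
    (hκ : ∀ g h p, κ (g * h) p = κ g (h • p) * κ h p) : G →* Equiv.Perm (P × C) :=
  letI : MulAction G (P × C) :=
    { smul := fun g x => (g • x.1, κ g x.1 * x.2)
      one_smul := fun x => by
        have h : κ 1 x.1 = 1 := by simpa using hκ 1 1 x.1
        change ((1 : G) • x.1, κ 1 x.1 * x.2) = x
        rw [h, one_smul, one_mul]
      mul_smul := fun g h x => by
        change ((g * h) • x.1, κ (g * h) x.1 * x.2) =
          (g • h • x.1, κ g (h • x.1) * (κ h x.1 * x.2))
        rw [hκ, mul_smul, mul_assoc] }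
  MulAction.toPermHom G (P × C)

theorem cocyclePermHom_apply {G P C : Type*} [Group G] [MulAction G P] [Group C] (κ : G → P → C)
    (hκ : ∀ g h p, κ (g * h) p = κ g (h • p) * κ h p) (g : G) (x : P × C) :
    cocyclePermHom κ hκ g x = (g • x.1, κ g x.1 * x.2) := rfl

/-- A section of `F → F ⧸ B` with value `1` at the base point and with values in `A` on its
`A`-orbit. -/
theorem Subgroup.exists_section_mem {F : Type*} [Group F] (A B : Subgroup F) :
    ∃ s : F ⧸ B → F, (∀ p, (s p : F ⧸ B) = p) ∧ s ((1 : F) : F ⧸ B) = 1 ∧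
      ∀ a ∈ A, s (a : F ⧸ B) ∈ A := by
  have hs (p : F ⧸ B) : ∃ s : F, (s : F ⧸ B) = p ∧ (p = ((1 : F) : F ⧸ B) → s = 1) ∧
      ((∃ a ∈ A, (a : F ⧸ B) = p) → s ∈ A) := by
    by_cases h1 : p = ((1 : F) : F ⧸ B)
    · exact ⟨1, h1.symm, fun _ => rfl, fun _ => A.one_mem⟩
    by_cases hp : ∃ a ∈ A, (a : F ⧸ B) = p
    · obtain ⟨a, ha, hap⟩ := hp
      exact ⟨a, hap, fun h => (h1 h).elim, fun _ => ha⟩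
    · obtain ⟨s, hs⟩ := QuotientGroup.mk_surjective p
      exact ⟨s, hs, fun h => (h1 h).elim, fun h => (hp h).elim⟩
  choose s hs h1 hA using hs
  exact ⟨s, hs, h1 _ rfl, fun a ha => hA _ ⟨a, ha, rfl⟩⟩

/-- The `A ⊓ B`-valued cocycle on `A × F ⧸ B` that is trivial off the `A`-orbit of the base point
and restricts to the inclusion of `A ⊓ B` at the base point. -/
theorem Subgroup.exists_cocycle {F : Type*} [Group F] (A B : Subgroup F) :
    ∃ κ : A → F ⧸ B → ↥(A ⊓ B), (∀ a a' p, κ (a * a') p = κ a (a' • p) * κ a' p) ∧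
      ∀ (a : A) (h : (a : F) ∈ A ⊓ B), κ a ((1 : F) : F ⧸ B) = ⟨a, h⟩ := by
  classical
  obtain ⟨s, hs, hs1, hsA⟩ := A.exists_section_mem B
  let O : Set (F ⧸ B) := MulAction.orbit A ((1 : F) : F ⧸ B)
  have hO {p : F ⧸ B} (hp : p ∈ O) : s p ∈ A := by
    obtain ⟨a, rfl⟩ := hp
    have : a • ((1 : F) : F ⧸ B) = ((a : F) : F ⧸ B) := by
      change ((a * 1 : F) : F ⧸ B) = _
      rw [mul_one]
    change s (a • ((1 : F) : F ⧸ B)) ∈ A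
    exact this ▸ hsA a a.2
  have hsmul (a : A) (p : F ⧸ B) : a • p ∈ O ↔ p ∈ O := by
    simp only [O, ← MulAction.orbit_eq_iff, MulAction.orbit_smul]
  have hmem (a : A) {p : F ⧸ B} (hp : p ∈ O) : (s (a • p))⁻¹ * a * s p ∈ A ⊓ B := by
    refine ⟨A.mul_mem (A.mul_mem (A.inv_mem (hO ?_)) a.2) (hO hp), ?_⟩
    · exact (hsmul a p).2 hp
    · change (s (a • p))⁻¹ * a * s p ∈ B
      rw [mul_assoc, ← QuotientGroup.eq, hs]
      conv_lhs => rw [← hs p]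
      rfl
  refine ⟨fun a p => if hp : p ∈ O then ⟨_, hmem a hp⟩ else 1, fun a a' p => ?_, fun a h => ?_⟩
  · by_cases hp : p ∈ O
    · have hp' : a' • p ∈ O := (hsmul a' p).2 hp
      ext
      simp [hp, hp', mul_smul, mul_assoc]
    · have hp' : a' • p ∉ O := fun h => hp ((hsmul a' p).1 h)
      simp [hp, hp']
  · have ho : ((1 : F) : F ⧸ B) ∈ O := MulAction.mem_orbit_self _
    have ha : a • ((1 : F) : F ⧸ B) = ((1 : F) : F ⧸ B) := by
      change ((a * 1 : F) : F ⧸ B) = _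
      rw [mul_one, QuotientGroup.eq]
      simpa using h.2
    ext
    simp [ho, ha, hs1]

/-- If `A` is a free factor of `F`, then `A ⊓ B` is a retract of `B`. -/
theorem IsFreeFactor.exists_retraction {F : Type*} [Group F] {A : Subgroup F}
    (hA : IsFreeFactor A) (B : Subgroup F) :
    ∃ r : B →* ↥(A ⊓ B), ∀ (b : B) (h : (b : F) ∈ A ⊓ B), r b = ⟨b, h⟩ := by
  obtain ⟨A', hbij⟩ := hA
  obtain ⟨κ, hκ, hκ1⟩ := A.exists_cocycle B
  let e := MulEquiv.ofBijective _ hbij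
  let θ : Monoid.Coprod A A' →* Equiv.Perm ((F ⧸ B) × ↥(A ⊓ B)) :=
    Monoid.Coprod.lift (cocyclePermHom κ hκ) (cocyclePermHom (fun _ _ => 1) (by simp))
  have hθ (m : Monoid.Coprod A A') :
      ∀ p c, θ m (p, c) = (e m • p, (θ m (p, 1)).2 * c) := by
    induction m using Monoid.Coprod.induction_on with
    | inl a => intro p c; simp [θ, e, cocyclePermHom_apply]; rfl
    | inr a => intro p c; simp [θ, e, cocyclePermHom_apply]; rfl
    | mul m n hm hn =>
      intro p c
      rw [map_mul, map_mul, Equiv.Perm.mul_apply, Equiv.Perm.mul_apply, hn p c, hn p 1, hm,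
        hm _ (_ * 1)]
      simp [mul_smul, mul_assoc]
  let o : F ⧸ B := ((1 : F) : F ⧸ B)
  have ho (b : B) : (b : F) • o = o := by
    change ((b * 1 : F) : F ⧸ B) = _
    rw [mul_one, QuotientGroup.eq]
    simp
  have hr (b : B) (c : ↥(A ⊓ B)) :
      θ (e.symm b) (o, c) = (o, (θ (e.symm b) (o, 1)).2 * c) := by
    rw [hθ, e.apply_symm_apply, ho]
  refine ⟨MonoidHom.mk' (fun b => (θ (e.symm b) (o, 1)).2) fun b b' => ?_, fun b h => ?_⟩
  · rw [Subgroup.coe_mul, map_mul, map_mul, Equiv.Perm.mul_apply, hr b', hr b, mul_one]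
  · have hb : e.symm b = Monoid.Coprod.inl ⟨b, h.1⟩ := by
      rw [MulEquiv.symm_apply_eq]
      simp [e]
    simp [hb, θ, cocyclePermHom_apply, o, hκ1 ⟨b, h.1⟩ h]

/-- A noncyclic retract of a free group of rank two is the whole group. -/
theorem HasRank.le_of_retraction {α : Type*} {B C : Subgroup (FreeGroup α)} (hB : HasRank B 2)
    (hC : ¬IsCyclic C) (hCB : C ≤ B) (r : B →* C)
    (hr : ∀ (b : B) (h : (b : FreeGroup α) ∈ C), r b = ⟨b, h⟩) : B ≤ C := by
  obtain ⟨e⟩ := hB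
  have hrs : Surjective r := fun c => ⟨⟨c, hCB c.2⟩, hr _ c.2⟩
  let e' := IsFreeGroup.toFreeGroup C
  let f : FreeGroup (Fin 2) →* FreeGroup (IsFreeGroup.Generators C) :=
    (e'.toMonoidHom.comp r).comp e.symm.toMonoidHom
  have hf : Surjective f := (e'.surjective.comp hrs).comp e.symm.surjective
  have := FreeGroup.finite_of_surjective hf
  have hcard : Nat.card (Fin 2) ≤ Nat.card (IsFreeGroup.Generators C) := by
    by_contra h
    rw [Nat.card_fin] at h
    exact hC (e'.isCyclic.2 (FreeGroup.isCyclic_of_card_le_one (by omega)))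
  have hfi : Injective f := FreeGroup.injective_of_surjective hcard hf
  have hri : Injective r := fun x y hxy => e.injective <| hfi <| by simp [f, hxy]
  intro b hb
  have : r ⟨b, hb⟩ = r ⟨r ⟨b, hb⟩, hCB (r ⟨b, hb⟩).2⟩ :=
    (hr ⟨_, hCB (r ⟨b, hb⟩).2⟩ (r ⟨b, hb⟩).2).symm
  have h := congrArg Subtype.val (hri this)
  simp only at h
  rw [h]
  exact (r ⟨b, hb⟩).2

/-- Distinct rank-2 free factors of a free group intersect in a
cyclic (possibly trivial) subgroup. -/
theorem statement9 {α : Type*} (A B : Subgroup (FreeGroup α))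
    (hA : IsFreeFactor A) (hB : IsFreeFactor B)
    (hA2 : HasRank A 2) (hB2 : HasRank B 2) (hne : A ≠ B) :
    IsCyclic ↥(A ⊓ B) := by
  by_contra hC
  obtain ⟨r, hr⟩ := hA.exists_retraction B
  have hBA : B ≤ A := (hB2.le_of_retraction hC inf_le_right r hr).trans inf_le_left
  rw [inf_comm] at hC
  obtain ⟨r', hr'⟩ := hB.exists_retraction A
  have hAB : A ≤ B := (hA2.le_of_retraction hC inf_le_right r' hr').trans inf_le_left
  exact hne (hAB.antisymm hBA)
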